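/- arXiv:1609.04675 — 5 statements merged into one kernel-verified Lean document; each statement's English description precedes it below -/
import Mathlib

section
/- Let w : ℝ → ℝ be four times continuously differentiable on [0,L] and suppose w satisfies the nonlinear Gao beam equation E I w''''(x) − E α w'(x)² w''(x) + E λ w''(x) = f(x) for all x ∈ [0,L], where f : [0,L] → ℝ is continuous. Then the first variation of the total potential energy Π vanishes at w in every direction φ that is twice continuously differentiable with φ(0) = φ(L) = φ'(0) = φ'(L) = 0; that is, ∫₀ᴸ ( E I w''(x) φ''(x) + (1/3) E α w'(x)³ φ'(x) − E λ w'(x) φ'(x) − f(x) φ(x) ) dx = 0. -/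
/-- On a set of unique differentiability, the iterated derivative of order `k` of a `C^n` function,
`k < n`, has the iterated derivative of order `k + 1` as its derivative. -/
lemma ContDiffOn.hasDerivWithinAt_iteratedDerivWithin {g : ℝ → ℝ} {s : Set ℝ} {n k : ℕ}
    (hg : ContDiffOn ℝ n g s) (hk : k < n) (hs : UniqueDiffOn ℝ s) {x : ℝ} (hx : x ∈ s) :
    HasDerivWithinAt (iteratedDerivWithin k g s) (iteratedDerivWithin (k + 1) g s x) s x := by
  rw [iteratedDerivWithin_succ]
  exact (hg.differentiableOn_iteratedDerivWithin (by exact_mod_cast hk) hs x hx).hasDerivWithinAt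

/-- If `w` is four times continuously differentiable on `[0,L]` and satisfies the
nonlinear Gao beam equation `E I w'''' − E α (w')² w'' + E λ w'' = f` on `[0,L]`,
then the first variation of the total potential energy `Π` vanishes at `w` in every
direction `φ` that is twice continuously differentiable with
`φ(0) = φ(L) = φ'(0) = φ'(L) = 0`. -/
theorem stmt_4 (E α lam I L : ℝ) (hE : 0 < E) (hα : 0 < α) (hlam : 0 < lam)
    (hI : 0 < I) (hL : 0 < L) (f : ℝ → ℝ) (hf : ContinuousOn f (Set.Icc 0 L))
    (w : ℝ → ℝ) (hw : ContDiffOn ℝ 4 w (Set.Icc 0 L))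
    (heq : ∀ x ∈ Set.Icc (0:ℝ) L,
      E * I * iteratedDerivWithin 4 w (Set.Icc 0 L) x -
          E * α * (derivWithin w (Set.Icc 0 L) x) ^ 2 *
            iteratedDerivWithin 2 w (Set.Icc 0 L) x +
          E * lam * iteratedDerivWithin 2 w (Set.Icc 0 L) x = f x) :
    ∀ φ : ℝ → ℝ, ContDiffOn ℝ 2 φ (Set.Icc 0 L) →
      φ 0 = 0 → φ L = 0 →
      derivWithin φ (Set.Icc 0 L) 0 = 0 → derivWithin φ (Set.Icc 0 L) L = 0 →
      ∫ x in (0:ℝ)..L,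
        (E * I * iteratedDerivWithin 2 w (Set.Icc 0 L) x *
            iteratedDerivWithin 2 φ (Set.Icc 0 L) x +
          (1/3) * E * α * (derivWithin w (Set.Icc 0 L) x) ^ 3 *
            derivWithin φ (Set.Icc 0 L) x -
          E * lam * derivWithin w (Set.Icc 0 L) x * derivWithin φ (Set.Icc 0 L) x -
          f x * φ x) = 0 := by
  intro φ hφ hφ0 hφL hφ0' hφL'
  set s := Set.Icc (0 : ℝ) L
  have hs : UniqueDiffOn ℝ s := uniqueDiffOn_Icc hL
  have hw1 : derivWithin w s = iteratedDerivWithin 1 w s := iteratedDerivWithin_one.symm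
  have hφ1 : derivWithin φ s = iteratedDerivWithin 1 φ s := iteratedDerivWithin_one.symm
  rw [hφ1] at hφ0' hφL'
  rw [hw1] at heq
  rw [hw1, hφ1]
  have dw (k : ℕ) (hk : k < 4) {x : ℝ} (hx : x ∈ s) :=
    ContDiffOn.hasDerivWithinAt_iteratedDerivWithin (n := 4) hw hk hs hx
  have dφ (k : ℕ) (hk : k < 2) {x : ℝ} (hx : x ∈ s) :=
    ContDiffOn.hasDerivWithinAt_iteratedDerivWithin (n := 2) hφ hk hs hx
  have cw (k : ℕ) (hk : k < 4) : ContinuousOn (iteratedDerivWithin k w s) s :=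
    fun x hx => (dw k hk hx).continuousWithinAt
  have cφ (k : ℕ) (hk : k < 2) : ContinuousOn (iteratedDerivWithin k φ s) s :=
    fun x hx => (dφ k hk hx).continuousWithinAt
  have cφ2 : ContinuousOn (iteratedDerivWithin 2 φ s) s :=
    hφ.continuousOn_iteratedDerivWithin le_rfl hs
  have cw1 := cw 1 (by norm_num)
  have cw2 := cw 2 (by norm_num)
  have cφ1 := cφ 1 (by norm_num)
  have cφ0 : ContinuousOn φ s := hφ.continuousOn
  let G : ℝ → ℝ := fun x =>
    E * I * (iteratedDerivWithin 2 w s x * iteratedDerivWithin 1 φ s x -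
      iteratedDerivWithin 3 w s x * φ x) +
    (1/3) * E * α * (iteratedDerivWithin 1 w s x ^ 3 * φ x) -
    E * lam * (iteratedDerivWithin 1 w s x * φ x)
  have dG {x : ℝ} (hx : x ∈ s) : HasDerivWithinAt G
      (E * I * iteratedDerivWithin 2 w s x * iteratedDerivWithin 2 φ s x +
        (1/3) * E * α * iteratedDerivWithin 1 w s x ^ 3 * iteratedDerivWithin 1 φ s x -
        E * lam * iteratedDerivWithin 1 w s x * iteratedDerivWithin 1 φ s x - f x * φ x) s x := by
    have w1 : HasDerivWithinAt _ (iteratedDerivWithin 2 w s x) s x := dw 1 (by norm_num) hx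
    have w2 : HasDerivWithinAt _ (iteratedDerivWithin 3 w s x) s x := dw 2 (by norm_num) hx
    have w3 : HasDerivWithinAt _ (iteratedDerivWithin 4 w s x) s x := dw 3 (by norm_num) hx
    have φ0 : HasDerivWithinAt _ (iteratedDerivWithin 1 φ s x) s x := dφ 0 (by norm_num) hx
    have φ1 : HasDerivWithinAt _ (iteratedDerivWithin 2 φ s x) s x := dφ 1 (by norm_num) hx
    rw [iteratedDerivWithin_zero] at φ0
    refine (((((w2.mul φ1).sub (w3.mul φ0)).const_mul (E * I)).add
      (((w1.pow 3).mul φ0).const_mul ((1/3) * E * α))).sub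
      ((w1.mul φ0).const_mul (E * lam))).congr_deriv ?_
    rw [← heq x hx]
    simp only [Pi.pow_apply]
    push_cast
    ring
  have h0 : G 0 = 0 := by simp only [G, hφ0, hφ0']; ring
  have h1 : G L = 0 := by simp only [G, hφL, hφL']; ring
  rw [intervalIntegral.integral_eq_sub_of_hasDerivAt_of_le hL.le
    (f := G) (fun x hx => (dG hx).continuousWithinAt)
    (fun x hx => (dG (Set.Ioo_subset_Icc_self hx)).hasDerivAt (Icc_mem_nhds hx.1 hx.2)), h0, h1,
    sub_zero]
  apply ContinuousOn.intervalIntegrable_of_Icc hL.le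
  fun_prop
end

section
/- (Discrete complementary-duality principle.) If (w̄,σ̄) is a stationary point of Ξ and G(σ̄) is invertible, then Π_p(w̄) = Ξ(w̄,σ̄) = Π_d(σ̄); that is, at a stationary point the total potential, the total complementary energy and the canonical dual function all take the same value. -/
open Matrix

/-- `G σ = A + Σ σ_i B_i`. -/
noncomputable def G {n p : ℕ} (A : Matrix (Fin n) (Fin n) ℝ)
    (B : Fin p → Matrix (Fin n) (Fin n) ℝ) (σ : Fin p → ℝ) : Matrix (Fin n) (Fin n) ℝ :=
  A + ∑ i, σ i • B i

/-- The total complementary energy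
`Ξ(w,σ) = (1/2) wᵀ G(σ) w − (1/2) σᵀ K σ − ℓᵀ σ − fᵀ w − c`. -/
noncomputable def Xi {n p : ℕ} (A : Matrix (Fin n) (Fin n) ℝ)
    (B : Fin p → Matrix (Fin n) (Fin n) ℝ) (K : Matrix (Fin p) (Fin p) ℝ)
    (f : Fin n → ℝ) (ℓ : Fin p → ℝ) (c : ℝ) (w : Fin n → ℝ) (σ : Fin p → ℝ) : ℝ :=
  (1/2) * (w ⬝ᵥ (G A B σ).mulVec w) - (1/2) * (σ ⬝ᵥ K.mulVec σ) - ℓ ⬝ᵥ σ - f ⬝ᵥ w - c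

/-- `h(w)_i = (1/2) wᵀ B_i w`. -/
noncomputable def hq {n p : ℕ} (B : Fin p → Matrix (Fin n) (Fin n) ℝ)
    (w : Fin n → ℝ) : Fin p → ℝ :=
  fun i => (1/2) * (w ⬝ᵥ (B i).mulVec w)

/-- The total potential `Π_p(w) = sup_{σ} Ξ(w,σ)`. -/
noncomputable def Pip {n p : ℕ} (A : Matrix (Fin n) (Fin n) ℝ)
    (B : Fin p → Matrix (Fin n) (Fin n) ℝ) (K : Matrix (Fin p) (Fin p) ℝ)
    (f : Fin n → ℝ) (ℓ : Fin p → ℝ) (c : ℝ) (w : Fin n → ℝ) : ℝ :=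
  ⨆ σ : Fin p → ℝ, Xi A B K f ℓ c w σ

/-- The canonical dual function
`Π_d(σ) = −(1/2) fᵀ G(σ)⁻¹ f − (1/2) σᵀ K σ − ℓᵀ σ − c`. -/
noncomputable def Pid {n p : ℕ} (A : Matrix (Fin n) (Fin n) ℝ)
    (B : Fin p → Matrix (Fin n) (Fin n) ℝ) (K : Matrix (Fin p) (Fin p) ℝ)
    (f : Fin n → ℝ) (ℓ : Fin p → ℝ) (c : ℝ) (σ : Fin p → ℝ) : ℝ :=
  -(1/2) * (f ⬝ᵥ (G A B σ)⁻¹.mulVec f) - (1/2) * (σ ⬝ᵥ K.mulVec σ) - ℓ ⬝ᵥ σ - c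

/-- `wᵀ G(σ) w / 2` is affine in `σ` with gradient `h(w)`. -/
theorem half_quadratic_G {n p : ℕ} (A : Matrix (Fin n) (Fin n) ℝ)
    (B : Fin p → Matrix (Fin n) (Fin n) ℝ) (w : Fin n → ℝ) (σ : Fin p → ℝ) :
    (1/2) * (w ⬝ᵥ (G A B σ).mulVec w) = (1/2) * (w ⬝ᵥ A.mulVec w) + hq B w ⬝ᵥ σ := by
  have h : hq B w ⬝ᵥ σ = (1/2) * ∑ i, σ i * (w ⬝ᵥ (B i).mulVec w) := by
    rw [Finset.mul_sum]
    exact Finset.sum_congr rfl fun i _ => by simp only [hq]; ring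
  rw [h, G, add_mulVec, sum_mulVec, dotProduct_add, dotProduct_sum, mul_add]
  simp only [smul_mulVec, dotProduct_smul, smul_eq_mul]

/-- If `σ₀` is a critical point of `Ξ(w, ·)`, then `Ξ(w, ·)` equals its value at `σ₀` minus
the quadratic form of `K` at the displacement. -/
theorem Xi_eq_sub_of_critical {n p : ℕ} {A : Matrix (Fin n) (Fin n) ℝ}
    {B : Fin p → Matrix (Fin n) (Fin n) ℝ} {K : Matrix (Fin p) (Fin p) ℝ} (hK : K.IsSymm)
    {f : Fin n → ℝ} {ℓ : Fin p → ℝ} {c : ℝ} {w : Fin n → ℝ} {σ₀ : Fin p → ℝ}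
    (h : hq B w - K.mulVec σ₀ - ℓ = 0) (σ : Fin p → ℝ) :
    Xi A B K f ℓ c w σ =
      Xi A B K f ℓ c w σ₀ - (1/2) * ((σ - σ₀) ⬝ᵥ K.mulVec (σ - σ₀)) := by
  have hh : hq B w = K.mulVec σ₀ + ℓ := by
    rw [sub_sub] at h
    exact sub_eq_zero.mp h
  have hsymm : σ₀ ⬝ᵥ K.mulVec σ = σ ⬝ᵥ K.mulVec σ₀ := by
    rw [dotProduct_mulVec, ← mulVec_transpose, hK.eq, dotProduct_comm]
  simp only [Xi, half_quadratic_G, hh, mulVec_sub, add_dotProduct, sub_dotProduct,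
    dotProduct_sub, hsymm, dotProduct_comm (K.mulVec σ₀)]
  ring

/-- Discrete complementary-duality principle: at a stationary point `(w̄,σ̄)` of `Ξ`
with `G(σ̄)` invertible, `Π_p(w̄) = Ξ(w̄,σ̄) = Π_d(σ̄)`. -/
theorem stmt_11 (n p : ℕ) (hn : 0 < n) (hp : 0 < p)
    (A : Matrix (Fin n) (Fin n) ℝ) (hA : A.IsSymm)
    (B : Fin p → Matrix (Fin n) (Fin n) ℝ) (hB : ∀ i, (B i).IsSymm)
    (K : Matrix (Fin p) (Fin p) ℝ) (hK : K.PosDef)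
    (f : Fin n → ℝ) (ℓ : Fin p → ℝ) (c : ℝ)
    (wbar : Fin n → ℝ) (σbar : Fin p → ℝ)
    (hstat1 : (G A B σbar).mulVec wbar = f)
    (hstat2 : hq B wbar - K.mulVec σbar - ℓ = 0)
    (hGinv : IsUnit (G A B σbar).det) :
    Pip A B K f ℓ c wbar = Xi A B K f ℓ c wbar σbar ∧
      Xi A B K f ℓ c wbar σbar = Pid A B K f ℓ c σbar := by
  constructor
  · have hsymm : K.IsSymm := by simpa using hK.isHermitian
    have hmax : ∀ σ, Xi A B K f ℓ c wbar σ ≤ Xi A B K f ℓ c wbar σbar := fun σ => by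
      have hnonneg : 0 ≤ (σ - σbar) ⬝ᵥ K.mulVec (σ - σbar) := by
        simpa using hK.posSemidef.dotProduct_mulVec_nonneg (σ - σbar)
      rw [Xi_eq_sub_of_critical hsymm hstat2 σ]
      linarith
    exact le_antisymm (ciSup_le hmax)
      (le_ciSup ⟨_, Set.forall_mem_range.mpr hmax⟩ σbar)
  · have hw : (G A B σbar)⁻¹.mulVec f = wbar := by
      rw [← hstat1, mulVec_mulVec, nonsing_inv_mul _ hGinv, one_mulVec]
    rw [Xi, Pid, hw, hstat1, dotProduct_comm wbar f]
    ring
end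

section
/- (Saddle-point property for nonnegative gap.) If (w̄,σ̄) is a stationary point of Ξ and G(σ̄) is positive semidefinite, then (w̄,σ̄) is a saddle point of Ξ: for all w ∈ ℝⁿ and all σ ∈ ℝᵖ, Ξ(w̄,σ) ≤ Ξ(w̄,σ̄) ≤ Ξ(w,σ̄). -/
open Matrix

/-- Young's inequality for the bilinear form of a positive semidefinite matrix. -/
theorem Matrix.PosSemidef.mulVec_dotProduct_le {m : ℕ} {M : Matrix (Fin m) (Fin m) ℝ}
    (hM : M.PosSemidef) (x y : Fin m → ℝ) :
    M.mulVec y ⬝ᵥ x ≤ (1/2) * (x ⬝ᵥ M.mulVec x) + (1/2) * (y ⬝ᵥ M.mulVec y) := by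
  have h := hM.dotProduct_mulVec_nonneg (x - y)
  have hT : Mᵀ = M := by simpa [Matrix.IsHermitian] using hM.isHermitian
  have hsymm : y ⬝ᵥ M.mulVec x = M.mulVec y ⬝ᵥ x := by
    rw [dotProduct_mulVec, ← mulVec_transpose, hT]
  have hcomm : x ⬝ᵥ M.mulVec y = M.mulVec y ⬝ᵥ x := dotProduct_comm _ _
  simp only [star_trivial, mulVec_sub, dotProduct_sub, sub_dotProduct] at h
  linarith

/-- The quadratic form of `G σ` is affine in `σ`, with linear part given by `hq`. -/
theorem half_dotProduct_G_mulVec {n p : ℕ} (A : Matrix (Fin n) (Fin n) ℝ)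
    (B : Fin p → Matrix (Fin n) (Fin n) ℝ) (σ : Fin p → ℝ) (w : Fin n → ℝ) :
    (1/2) * (w ⬝ᵥ (G A B σ).mulVec w) = (1/2) * (w ⬝ᵥ A.mulVec w) + hq B w ⬝ᵥ σ := by
  simp only [G, add_mulVec, sum_mulVec, smul_mulVec, dotProduct_add, dotProduct_sum,
    dotProduct_smul, smul_eq_mul, mul_add, Finset.mul_sum]
  congr 1
  exact Finset.sum_congr rfl fun i _ => by simp only [hq]; ring

/-- Saddle-point property for nonnegative gap: if `(w̄,σ̄)` is a stationary point
of `Ξ` and `G(σ̄)` is positive semidefinite, then `(w̄,σ̄)` is a saddle point of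
`Ξ`: `Ξ(w̄,σ) ≤ Ξ(w̄,σ̄) ≤ Ξ(w,σ̄)` for all `w`, `σ`. -/
theorem stmt_12 (n p : ℕ) (hn : 0 < n) (hp : 0 < p)
    (A : Matrix (Fin n) (Fin n) ℝ) (hA : A.IsSymm)
    (B : Fin p → Matrix (Fin n) (Fin n) ℝ) (hB : ∀ i, (B i).IsSymm)
    (K : Matrix (Fin p) (Fin p) ℝ) (hK : K.PosDef)
    (f : Fin n → ℝ) (ℓ : Fin p → ℝ) (c : ℝ)
    (wbar : Fin n → ℝ) (σbar : Fin p → ℝ)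
    (hstat1 : (G A B σbar).mulVec wbar = f)
    (hstat2 : hq B wbar - K.mulVec σbar - ℓ = 0)
    (hGpsd : (G A B σbar).PosSemidef) :
    ∀ (w : Fin n → ℝ) (σ : Fin p → ℝ),
      Xi A B K f ℓ c wbar σ ≤ Xi A B K f ℓ c wbar σbar ∧
        Xi A B K f ℓ c wbar σbar ≤ Xi A B K f ℓ c w σbar := by
  intro w σ
  constructor
  · have hℓ : ℓ = hq B wbar - K.mulVec σbar := (sub_eq_zero.mp hstat2).symm
    have h := hK.posSemidef.mulVec_dotProduct_le σ σbar
    have hcomm : σbar ⬝ᵥ K.mulVec σbar = K.mulVec σbar ⬝ᵥ σbar := dotProduct_comm _ _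
    simp only [Xi, half_dotProduct_G_mulVec, hℓ, sub_dotProduct]
    linarith
  · have h := hGpsd.mulVec_dotProduct_le w wbar
    have hcomm : wbar ⬝ᵥ (G A B σbar).mulVec wbar = f ⬝ᵥ wbar := by
      rw [hstat1, dotProduct_comm]
    rw [hcomm, hstat1] at h
    simp only [Xi]
    linarith
end

section
/- (Canonical double-min duality.) Suppose n = p. If (w̄,σ̄) is a stationary point of Ξ with σ̄ ∈ S⁻ (i.e. G(σ̄) is negative definite), then w̄ is a local minimizer of Π_p on ℝⁿ if and only if σ̄ is a local minimizer of Π_d on S⁻, and in that case Π_p(w̄) = Π_d(σ̄). -/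
open Matrix

open Filter Topology

lemma Matrix.IsSymm.dotProduct_mulVec_comm {n : ℕ} {M : Matrix (Fin n) (Fin n) ℝ}
    (hM : M.IsSymm) (x y : Fin n → ℝ) : x ⬝ᵥ M *ᵥ y = y ⬝ᵥ M *ᵥ x := by
  rw [Matrix.dotProduct_mulVec, ← Matrix.mulVec_transpose, hM.eq, dotProduct_comm]

lemma Matrix.PosDef.isSymm {n : ℕ} {M : Matrix (Fin n) (Fin n) ℝ} (hM : M.PosDef) : M.IsSymm := by
  rw [Matrix.IsSymm, ← Matrix.conjTranspose_eq_transpose_of_trivial]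
  exact hM.isHermitian

/-- Being positive definite is an open condition along a continuous family of symmetric matrices. -/
lemma eventually_posDef {X : Type*} [TopologicalSpace X] {n : ℕ}
    {M : X → Matrix (Fin n) (Fin n) ℝ} (hM : Continuous M) (hsymm : ∀ x, (M x).IsSymm)
    {x₀ : X} (h : (M x₀).PosDef) : ∀ᶠ x in 𝓝 x₀, (M x).PosDef := by
  have hc : Continuous fun q : X × (Fin n → ℝ) => q.2 ⬝ᵥ (M q.1) *ᵥ q.2 := by fun_prop
  have key : ∀ᶠ x in 𝓝 x₀, ∀ v ∈ Metric.sphere (0 : Fin n → ℝ) 1, 0 < v ⬝ᵥ (M x) *ᵥ v := by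
    refine (isCompact_sphere _ _).eventually_forall_of_forall_eventually fun v hv => ?_
    have hv0 : v ≠ 0 := by
      rintro rfl
      simp at hv
    have hpos := h.dotProduct_mulVec_pos hv0
    rw [star_trivial] at hpos
    exact (hc.tendsto (x₀, v)).eventually (lt_mem_nhds hpos)
  filter_upwards [key] with x hx
  refine Matrix.PosDef.of_dotProduct_mulVec_pos ?_ fun v hv => ?_
  · rw [Matrix.IsHermitian, Matrix.conjTranspose_eq_transpose_of_trivial]
    exact hsymm x
  · have hn : 0 < ‖v‖ := norm_pos_iff.mpr hv
    have := hx (‖v‖⁻¹ • v) (by simp [norm_smul, hn.ne'])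
    rw [Matrix.mulVec_smul, smul_dotProduct, dotProduct_smul, smul_eq_mul, smul_eq_mul] at this
    rw [star_trivial]
    have h1 : 0 < ‖v‖⁻¹ := inv_pos.mpr hn
    exact pos_of_mul_pos_right (pos_of_mul_pos_right this h1.le) h1.le

section CanonicalDuality

variable {n p : ℕ} {A : Matrix (Fin n) (Fin n) ℝ} {B : Fin p → Matrix (Fin n) (Fin n) ℝ}
  {K : Matrix (Fin p) (Fin p) ℝ} {f : Fin n → ℝ} {ℓ : Fin p → ℝ} {c : ℝ}

lemma isSymm_G (hA : A.IsSymm) (hB : ∀ i, (B i).IsSymm) (σ : Fin p → ℝ) : (G A B σ).IsSymm := by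
  simp only [G, Matrix.IsSymm, Matrix.transpose_add, Matrix.transpose_sum, Matrix.transpose_smul,
    hA.eq, (hB _).eq]

lemma continuous_G : Continuous (G A B) := by
  unfold G
  fun_prop

lemma G_mulVec (σ : Fin p → ℝ) (w : Fin n → ℝ) :
    G A B σ *ᵥ w = A *ᵥ w + ∑ i, σ i • (B i *ᵥ w) := by
  simp only [G, Matrix.add_mulVec, Matrix.sum_mulVec, Matrix.smul_mulVec]

lemma dotProduct_G_mulVec (σ : Fin p → ℝ) (w : Fin n → ℝ) :
    w ⬝ᵥ G A B σ *ᵥ w = w ⬝ᵥ A *ᵥ w + 2 * (hq B w ⬝ᵥ σ) := by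
  rw [G_mulVec, dotProduct_add, dotProduct_sum]
  congr 1
  simp only [dotProduct, hq, Finset.mul_sum, smul_eq_mul, Pi.smul_apply, Finset.sum_mul]
  refine Finset.sum_congr rfl fun i _ => Finset.sum_congr rfl fun j _ => ?_
  ring

lemma Xi_eq_sub (hK : K.IsSymm) {w : Fin n → ℝ} {σ : Fin p → ℝ}
    (hσ : hq B w - K *ᵥ σ - ℓ = 0) (τ : Fin p → ℝ) :
    Xi A B K f ℓ c w τ = Xi A B K f ℓ c w σ - (1/2) * ((τ - σ) ⬝ᵥ K *ᵥ (τ - σ)) := by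
  have hh : hq B w = K *ᵥ σ + ℓ := by
    rw [← sub_eq_zero, ← hσ]; abel
  have hc := hK.dotProduct_mulVec_comm σ τ
  simp only [Xi, dotProduct_G_mulVec, hh, add_dotProduct, Matrix.mulVec_sub, sub_dotProduct,
    dotProduct_sub, dotProduct_comm (K *ᵥ σ)]
  linarith

lemma Pip_eq_Xi (hK : K.PosDef) {w : Fin n → ℝ} {σ : Fin p → ℝ}
    (hσ : hq B w - K *ᵥ σ - ℓ = 0) : Pip A B K f ℓ c w = Xi A B K f ℓ c w σ := by
  have hKs := hK.isSymm
  have hle : ∀ τ, Xi A B K f ℓ c w τ ≤ Xi A B K f ℓ c w σ := fun τ => by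
    have := hK.posSemidef.dotProduct_mulVec_nonneg (τ - σ)
    rw [star_trivial] at this
    rw [Xi_eq_sub hKs hσ τ]
    linarith
  exact le_antisymm (ciSup_le hle) (le_ciSup (f := Xi A B K f ℓ c w) ⟨_, by
    rintro _ ⟨τ, rfl⟩
    exact hle τ⟩ σ)

lemma exists_hq_sub_mulVec_eq_zero (hK : K.PosDef) (w : Fin n → ℝ) :
    ∃ σ, hq B w - K *ᵥ σ - ℓ = 0 := by
  refine ⟨K⁻¹ *ᵥ (hq B w - ℓ), ?_⟩
  rw [Matrix.mulVec_mulVec, Matrix.mul_nonsing_inv _ ((Matrix.isUnit_iff_isUnit_det _).mp hK.isUnit),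
    Matrix.one_mulVec]
  abel

lemma Xi_le_Pip (hK : K.PosDef) (w : Fin n → ℝ) (τ : Fin p → ℝ) :
    Xi A B K f ℓ c w τ ≤ Pip A B K f ℓ c w := by
  obtain ⟨σ, hσ⟩ := exists_hq_sub_mulVec_eq_zero (B := B) (ℓ := ℓ) hK w
  have hKs := hK.isSymm
  have := hK.posSemidef.dotProduct_mulVec_nonneg (τ - σ)
  rw [star_trivial] at this
  rw [Pip_eq_Xi hK hσ, Xi_eq_sub hKs hσ τ]
  linarith

lemma isUnit_det_of_neg_posDef {M : Matrix (Fin n) (Fin n) ℝ} (hM : (-M).PosDef) :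
    IsUnit M.det :=
  (Matrix.isUnit_iff_isUnit_det _).mp (by simpa using hM.isUnit)

lemma Xi_eq_Pid {σ : Fin p → ℝ} (hG : (-(G A B σ)).PosDef) {w : Fin n → ℝ}
    (hw : G A B σ *ᵥ w = f) : Xi A B K f ℓ c w σ = Pid A B K f ℓ c σ := by
  have hx : (G A B σ)⁻¹ *ᵥ f = w := by
    rw [← hw, Matrix.mulVec_mulVec, Matrix.nonsing_inv_mul _ (isUnit_det_of_neg_posDef hG),
      Matrix.one_mulVec]
  rw [Xi, Pid, hx, hw, dotProduct_comm w f]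
  ring

lemma Xi_sub_Xi_of_mulVec_eq (hA : A.IsSymm) (hB : ∀ i, (B i).IsSymm) {σ : Fin p → ℝ}
    {x : Fin n → ℝ} (hx : G A B σ *ᵥ x = f) (v : Fin n → ℝ) :
    Xi A B K f ℓ c (x + v) σ = Xi A B K f ℓ c x σ + (1/2) * (v ⬝ᵥ G A B σ *ᵥ v) := by
  have hc := (isSymm_G hA hB σ).dotProduct_mulVec_comm x v
  rw [hx] at hc
  simp only [Xi, Matrix.mulVec_add, dotProduct_add, add_dotProduct, hx, hc, dotProduct_comm f]
  ring

lemma Xi_le_Pid (hA : A.IsSymm) (hB : ∀ i, (B i).IsSymm) {σ : Fin p → ℝ}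
    (hG : (-(G A B σ)).PosDef) (w : Fin n → ℝ) :
    Xi A B K f ℓ c w σ ≤ Pid A B K f ℓ c σ := by
  have hx : G A B σ *ᵥ ((G A B σ)⁻¹ *ᵥ f) = f := by
    rw [Matrix.mulVec_mulVec, Matrix.mul_nonsing_inv _ (isUnit_det_of_neg_posDef hG),
      Matrix.one_mulVec]
  have h1 := Xi_sub_Xi_of_mulVec_eq (K := K) (ℓ := ℓ) (c := c) hA hB hx (w - (G A B σ)⁻¹ *ᵥ f)
  have h2 := hG.posSemidef.dotProduct_mulVec_nonneg (w - (G A B σ)⁻¹ *ᵥ f)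
  rw [star_trivial, Matrix.neg_mulVec, dotProduct_neg] at h2
  rw [add_sub_cancel, Xi_eq_Pid hG hx] at h1
  linarith

/-- The matrix whose `i`-th column is `B i *ᵥ w`; its transpose is the Jacobian of `hq B` at `w`. -/
def columnMatrix (B : Fin p → Matrix (Fin n) (Fin n) ℝ) (w : Fin n → ℝ) :
    Matrix (Fin n) (Fin p) ℝ :=
  Matrix.of fun j i => (B i *ᵥ w) j

lemma columnMatrix_mulVec (w : Fin n → ℝ) (δ : Fin p → ℝ) :
    columnMatrix B w *ᵥ δ = ∑ i, δ i • (B i *ᵥ w) := by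
  ext j
  simp [columnMatrix, Matrix.mulVec, dotProduct, mul_comm]

lemma G_add_mulVec (σ δ : Fin p → ℝ) (w : Fin n → ℝ) :
    G A B (σ + δ) *ᵥ w = G A B σ *ᵥ w + columnMatrix B w *ᵥ δ := by
  simp only [G_mulVec, columnMatrix_mulVec, Pi.add_apply, add_smul, Finset.sum_add_distrib]
  abel

lemma hq_add_smul (hB : ∀ i, (B i).IsSymm) (w v : Fin n → ℝ) (t : ℝ) :
    hq B (w + t • v) = hq B w + t • ((columnMatrix B w)ᵀ *ᵥ v) + t ^ 2 • hq B v := by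
  ext i
  have h1 : ((columnMatrix B w)ᵀ *ᵥ v) i = v ⬝ᵥ B i *ᵥ w := by
    simp [columnMatrix, Matrix.mulVec, dotProduct, mul_comm]
  have hc := (hB i).dotProduct_mulVec_comm w v
  simp only [hq, Pi.add_apply, Pi.smul_apply, h1, Matrix.mulVec_add, Matrix.mulVec_smul,
    dotProduct_add, add_dotProduct, dotProduct_smul, smul_dotProduct, smul_eq_mul, hc]
  ring

lemma contDiff_hq : ContDiff ℝ 1 (hq B) := by
  unfold hq
  simp only [Matrix.mulVec, dotProduct]
  fun_prop

lemma fderiv_hq_apply (hB : ∀ i, (B i).IsSymm) (w v : Fin n → ℝ) :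
    fderiv ℝ (hq B) w v = (columnMatrix B w)ᵀ *ᵥ v := by
  have hd : HasFDerivAt (hq B) (fderiv ℝ (hq B) w) w :=
    (contDiff_hq.differentiable one_ne_zero w).hasFDerivAt
  have h1 : HasDerivAt (fun t : ℝ => hq B (w + t • v)) (fderiv ℝ (hq B) w v) 0 :=
    hd.hasLineDerivAt v
  have h2 : HasDerivAt (fun t : ℝ => hq B w + t • ((columnMatrix B w)ᵀ *ᵥ v) + t ^ 2 • hq B v)
      ((columnMatrix B w)ᵀ *ᵥ v) 0 := by
    have h3 := (((hasDerivAt_id (0 : ℝ)).smul_const ((columnMatrix B w)ᵀ *ᵥ v)).const_add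
      (hq B w)).add ((hasDerivAt_pow 2 (0 : ℝ)).smul_const (hq B v))
    refine (h3.congr_deriv (by simp)).congr_of_eventuallyEq (.of_forall fun t => ?_)
    simp
  simp only [hq_add_smul hB] at h1
  exact h1.unique h2

/-- At a local minimizer of the total potential, the Jacobian of `hq B` is injective. -/
lemma injective_of_isLocalMin_Pip (hA : A.IsSymm) (hB : ∀ i, (B i).IsSymm) (hK : K.PosDef)
    {w : Fin n → ℝ} {σ : Fin p → ℝ} (h1 : G A B σ *ᵥ w = f) (h2 : hq B w - K *ᵥ σ - ℓ = 0)
    (hG : (-(G A B σ)).PosDef) (hmin : IsLocalMin (Pip A B K f ℓ c) w) (v : Fin n → ℝ)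
    (hv : (columnMatrix B w)ᵀ *ᵥ v = 0) : v = 0 := by
  by_contra hv0
  obtain ⟨u, hu⟩ := exists_hq_sub_mulVec_eq_zero (B := B) (ℓ := 0) hK v
  have hKs := hK.isSymm
  have hneg := hG.dotProduct_mulVec_pos hv0
  rw [star_trivial, Matrix.neg_mulVec, dotProduct_neg] at hneg
  have hPip : ∀ t : ℝ, Pip A B K f ℓ c (w + t • v) = Pip A B K f ℓ c w +
      t ^ 2 * (1/2) * (v ⬝ᵥ G A B σ *ᵥ v + t ^ 2 * (u ⬝ᵥ K *ᵥ u)) := fun t => by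
    have ht : hq B (w + t • v) - K *ᵥ (σ + t ^ 2 • u) - ℓ = 0 := by
      rw [hq_add_smul hB, hv, Matrix.mulVec_add, Matrix.mulVec_smul]
      rw [sub_zero, sub_eq_zero] at hu
      rw [hu, smul_zero, add_zero, ← h2]
      abel
    have h3 := Xi_eq_sub (A := A) (f := f) (c := c) hKs ht σ
    rw [Xi_sub_Xi_of_mulVec_eq hA hB h1] at h3
    rw [Pip_eq_Xi hK ht, Pip_eq_Xi hK h2]
    simp only [sub_add_cancel_left, Matrix.mulVec_neg, Matrix.mulVec_smul, dotProduct_neg,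
      neg_dotProduct, dotProduct_smul, smul_dotProduct, smul_eq_mul] at h3
    linear_combination -h3
  have hline : Tendsto (fun t : ℝ => w + t • v) (𝓝[≠] 0) (𝓝 w) := by
    have : Continuous fun t : ℝ => w + t • v := by fun_prop
    simpa using (this.tendsto 0).mono_left nhdsWithin_le_nhds
  have hlim : Tendsto (fun t : ℝ => v ⬝ᵥ G A B σ *ᵥ v + t ^ 2 * (u ⬝ᵥ K *ᵥ u)) (𝓝[≠] 0)
      (𝓝 (v ⬝ᵥ G A B σ *ᵥ v)) := by
    have : Continuous fun t : ℝ => v ⬝ᵥ G A B σ *ᵥ v + t ^ 2 * (u ⬝ᵥ K *ᵥ u) := by fun_prop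
    simpa using (this.tendsto 0).mono_left nhdsWithin_le_nhds
  have hge : 0 ≤ v ⬝ᵥ G A B σ *ᵥ v := by
    refine ge_of_tendsto hlim ?_
    filter_upwards [hline.eventually hmin, self_mem_nhdsWithin] with t ht ht0
    rw [hPip t] at ht
    have ht2 : 0 < t ^ 2 * (1/2) := by
      have := pow_pos (abs_pos.mpr (Set.mem_compl_singleton_iff.mp ht0)) 2
      rw [sq_abs] at this
      positivity
    exact nonneg_of_mul_nonneg_right (by linarith) ht2
  linarith

/-- At a local minimizer of the canonical dual, the transposed Jacobian of `hq B` is injective. -/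
lemma injective_of_isLocalMin_Pid (hK : K.PosDef)
    {w : Fin n → ℝ} {σ : Fin p → ℝ} (h1 : G A B σ *ᵥ w = f) (h2 : hq B w - K *ᵥ σ - ℓ = 0)
    (hev : ∀ᶠ τ in 𝓝 σ, (-(G A B τ)).PosDef) (hmin : IsLocalMin (Pid A B K f ℓ c) σ)
    (δ : Fin p → ℝ) (hδ : columnMatrix B w *ᵥ δ = 0) : δ = 0 := by
  by_contra hδ0
  have hKs := hK.isSymm
  have hpos := hK.dotProduct_mulVec_pos hδ0
  rw [star_trivial] at hpos
  have hline : Tendsto (fun t : ℝ => σ + t • δ) (𝓝[≠] 0) (𝓝 σ) := by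
    have : Continuous fun t : ℝ => σ + t • δ := by fun_prop
    simpa using (this.tendsto 0).mono_left nhdsWithin_le_nhds
  obtain ⟨t, ⟨hGt, hmt⟩, ht0⟩ := ((hline.eventually (hev.and hmin)).and
    (self_mem_nhdsWithin (s := {(0 : ℝ)}ᶜ))).exists
  have hGw : G A B (σ + t • δ) *ᵥ w = f := by
    rw [G_add_mulVec, Matrix.mulVec_smul, hδ, smul_zero, add_zero, h1]
  rw [← Xi_eq_Pid hGt hGw, ← Xi_eq_Pid hev.self_of_nhds h1, Xi_eq_sub hKs h2 (σ + t • δ),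
    add_sub_cancel_left, Matrix.mulVec_smul, dotProduct_smul, smul_dotProduct, smul_eq_mul,
    smul_eq_mul] at hmt
  have := mul_pos (mul_self_pos.mpr (Set.mem_compl_singleton_iff.mp ht0)) hpos
  linarith

end CanonicalDuality

/-- If the Jacobian of `hq B` at `w` is invertible, a local minimizer of the total potential yields
a local minimizer of the canonical dual. -/
lemma isLocalMinOn_Pid_of_isLocalMin_Pip {n : ℕ} {A : Matrix (Fin n) (Fin n) ℝ}
    {B : Fin n → Matrix (Fin n) (Fin n) ℝ} {K : Matrix (Fin n) (Fin n) ℝ} {f ℓ : Fin n → ℝ} {c : ℝ}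
    (hA : A.IsSymm) (hB : ∀ i, (B i).IsSymm) (hK : K.PosDef) {w σ : Fin n → ℝ}
    (h1 : G A B σ *ᵥ w = f) (h2 : hq B w - K *ᵥ σ - ℓ = 0) (hG : (-(G A B σ)).PosDef)
    (hmin : IsLocalMin (Pip A B K f ℓ c) w) :
    IsLocalMinOn (Pid A B K f ℓ c) {σ | (-(G A B σ)).PosDef} σ := by
  have hinj : Function.Injective (fderiv ℝ (hq B) w) :=
    (injective_iff_map_eq_zero _).mpr fun v hv =>
      injective_of_isLocalMin_Pip hA hB hK h1 h2 hG hmin v (by rwa [← fderiv_hq_apply hB])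
  have hsurj : (fderiv ℝ (hq B) w).range = ⊤ :=
    LinearMap.range_eq_top.mpr (LinearMap.injective_iff_surjective.mp hinj)
  have hmap := (contDiff_hq.contDiffAt.hasStrictFDerivAt one_ne_zero).map_nhds_eq_of_surj hsurj
  have hval : K *ᵥ σ + ℓ = hq B w := by
    rw [eq_comm, ← sub_eq_zero, ← h2]
    abel
  have hcont : Tendsto (fun τ => K *ᵥ τ + ℓ) (𝓝 σ) (𝓝 (hq B w)) := by
    have : Continuous fun τ => K *ᵥ τ + ℓ := by fun_prop
    simpa only [hval] using this.tendsto σ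
  have himage : hq B '' {x | Pip A B K f ℓ c w ≤ Pip A B K f ℓ c x} ∈ 𝓝 (hq B w) := by
    rw [← hmap]
    exact image_mem_map hmin
  refine eventually_nhdsWithin_iff.mpr ?_
  filter_upwards [hcont himage] with τ ⟨x, hx, hxτ⟩ hτ
  have hst : hq B x - K *ᵥ τ - ℓ = 0 := by
    rw [hxτ, add_sub_cancel_left, sub_self]
  calc Pid A B K f ℓ c σ = Pip A B K f ℓ c w := by rw [Pip_eq_Xi hK h2, Xi_eq_Pid hG h1]
    _ ≤ Pip A B K f ℓ c x := hx
    _ = Xi A B K f ℓ c x τ := Pip_eq_Xi hK hst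
    _ ≤ Pid A B K f ℓ c τ := Xi_le_Pid hA hB hτ x

lemma isLocalMin_Pip_of_isLocalMin_Pid {n : ℕ} {A : Matrix (Fin n) (Fin n) ℝ}
    {B : Fin n → Matrix (Fin n) (Fin n) ℝ} {K : Matrix (Fin n) (Fin n) ℝ} {f ℓ : Fin n → ℝ} {c : ℝ}
    (hK : K.PosDef) {w σ : Fin n → ℝ}
    (h1 : G A B σ *ᵥ w = f) (h2 : hq B w - K *ᵥ σ - ℓ = 0)
    (hev : ∀ᶠ τ in 𝓝 σ, (-(G A B τ)).PosDef) (hmin : IsLocalMin (Pid A B K f ℓ c) σ) :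
    IsLocalMin (Pip A B K f ℓ c) w := by
  have hdet : (columnMatrix B w).det ≠ 0 := fun h0 => by
    obtain ⟨δ, hδ, hδ'⟩ := Matrix.exists_mulVec_eq_zero_iff.mpr h0
    exact hδ (injective_of_isLocalMin_Pid hK h1 h2 hev hmin δ hδ')
  have hcM : Continuous (columnMatrix B) := by
    refine continuous_matrix fun i j => ?_
    simp only [columnMatrix, Matrix.of_apply, Matrix.mulVec, dotProduct]
    fun_prop
  have hcdet : Continuous fun x => (columnMatrix B x).det := hcM.matrix_det
  let s : (Fin n → ℝ) → Fin n → ℝ := fun x =>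
    σ + (columnMatrix B x).det⁻¹ • ((columnMatrix B x).adjugate *ᵥ (f - G A B σ *ᵥ x))
  have hs : Tendsto s (𝓝 w) (𝓝 σ) := by
    have hc : ContinuousAt s w :=
      continuousAt_const.add ((hcdet.continuousAt.inv₀ hdet).smul
        (hcM.matrix_adjugate.matrix_mulVec (by fun_prop)).continuousAt)
    have hsw : s w = σ := by simp [s, h1]
    simpa only [ContinuousAt, hsw] using hc
  filter_upwards [hs.eventually (hev.and hmin), hcdet.continuousAt.eventually_ne hdet]
    with x ⟨hGx, hmx⟩ hdx
  have hGs : G A B (s x) *ᵥ x = f := by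
    rw [G_add_mulVec, Matrix.mulVec_smul, Matrix.mulVec_mulVec, Matrix.mul_adjugate,
      Matrix.smul_mulVec, Matrix.one_mulVec, inv_smul_smul₀ hdx, add_sub_cancel]
  calc Pip A B K f ℓ c w = Pid A B K f ℓ c σ := by
        rw [Pip_eq_Xi hK h2, Xi_eq_Pid hev.self_of_nhds h1]
    _ ≤ Pid A B K f ℓ c (s x) := hmx
    _ = Xi A B K f ℓ c x (s x) := (Xi_eq_Pid hGx hGs).symm
    _ ≤ Pip A B K f ℓ c x := Xi_le_Pip hK x _

/-- Canonical double-min duality (case `n = p`): if `(w̄,σ̄)` is a stationary point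
of `Ξ` with `G(σ̄)` negative definite, then `w̄` is a local minimizer of `Π_p` on
`ℝⁿ` if and only if `σ̄` is a local minimizer of `Π_d` on `S⁻`, and in that case
`Π_p(w̄) = Π_d(σ̄)`. -/
theorem stmt_16 (n p : ℕ) (hn : 0 < n) (hp : 0 < p) (hnp : n = p)
    (A : Matrix (Fin n) (Fin n) ℝ) (hA : A.IsSymm)
    (B : Fin p → Matrix (Fin n) (Fin n) ℝ) (hB : ∀ i, (B i).IsSymm)
    (K : Matrix (Fin p) (Fin p) ℝ) (hK : K.PosDef)
    (f : Fin n → ℝ) (ℓ : Fin p → ℝ) (c : ℝ)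
    (wbar : Fin n → ℝ) (σbar : Fin p → ℝ)
    (hstat1 : (G A B σbar).mulVec wbar = f)
    (hstat2 : hq B wbar - K.mulVec σbar - ℓ = 0)
    (hGnd : (-(G A B σbar)).PosDef) :
    (IsLocalMin (Pip A B K f ℓ c) wbar ↔
        IsLocalMinOn (Pid A B K f ℓ c) {σ : Fin p → ℝ | (-(G A B σ)).PosDef} σbar) ∧
      (IsLocalMin (Pip A B K f ℓ c) wbar →
        Pip A B K f ℓ c wbar = Pid A B K f ℓ c σbar) := by
  subst hnp
  have hev : ∀ᶠ τ in 𝓝 σbar, (-(G A B τ)).PosDef :=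
    eventually_posDef continuous_G.neg (fun τ => (isSymm_G hA hB τ).neg) hGnd
  refine ⟨⟨isLocalMinOn_Pid_of_isLocalMin_Pip hA hB hK hstat1 hstat2 hGnd, fun hmin =>
    isLocalMin_Pip_of_isLocalMin_Pid hK hstat1 hstat2 hev (hmin.isLocalMin hev)⟩, fun _ => ?_⟩
  rw [Pip_eq_Xi hK hstat2, Xi_eq_Pid hGnd hstat1]
end

section
/- (Concavity of the canonical dual function on S⁺.) The canonical dual function Π_d(σ) = −(1/2) fᵀ G(σ)⁻¹ f − (1/2) σᵀ K σ − ℓᵀ σ − c is concave on the convex set S⁺ = {σ ∈ ℝᵖ : G(σ) is positive definite}; in particular, the set S⁺ is convex and σ ↦ fᵀ G(σ)⁻¹ f is convex on S⁺. -/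
open Matrix

/-- The quadratic form of a positive semidefinite matrix is convex. -/
lemma Matrix.PosSemidef.convexOn_dotProduct_mulVec {m : Type*} [Fintype m] {M : Matrix m m ℝ}
    (hM : M.PosSemidef) : ConvexOn ℝ Set.univ (fun x : m → ℝ => x ⬝ᵥ M *ᵥ x) := by
  refine ⟨convex_univ, fun x _ y _ a b ha hb hab => ?_⟩
  have h := mul_nonneg (mul_nonneg ha hb) (hM.dotProduct_mulVec_nonneg (x - y))
  obtain rfl : b = 1 - a := by linarith
  simp only [star_trivial, mulVec_sub, mulVec_add, mulVec_smul, dotProduct_sub, sub_dotProduct,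
    dotProduct_add, add_dotProduct, smul_dotProduct, dotProduct_smul, smul_eq_mul] at h ⊢
  linarith

/-- Fenchel–Young inequality for the quadratic form of a positive definite matrix. -/
lemma Matrix.PosDef.two_mul_dotProduct_sub_le {m : Type*} [Fintype m] [DecidableEq m]
    {M : Matrix m m ℝ} (hM : M.PosDef) (f x : m → ℝ) :
    2 * (f ⬝ᵥ x) - x ⬝ᵥ M *ᵥ x ≤ f ⬝ᵥ M⁻¹ *ᵥ f := by
  have hf : M *ᵥ (M⁻¹ *ᵥ f) = f := by
    rw [mulVec_mulVec, mul_nonsing_inv _ ((isUnit_iff_isUnit_det M).1 hM.isUnit), one_mulVec]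
  have hT : Mᵀ = M := by simpa using hM.isHermitian.eq
  have hsymm : (M⁻¹ *ᵥ f) ⬝ᵥ M *ᵥ x = f ⬝ᵥ x := by
    rw [dotProduct_mulVec, ← mulVec_transpose, hT, hf]
  have h := hM.posSemidef.dotProduct_mulVec_nonneg (M⁻¹ *ᵥ f - x)
  simp only [star_trivial, mulVec_sub, dotProduct_sub, sub_dotProduct, hf, hsymm] at h
  rw [dotProduct_comm (M⁻¹ *ᵥ f) f, dotProduct_comm x f] at h
  linarith

/-- `M ↦ fᵀ M⁻¹ f` is convex on positive definite matrices. -/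
lemma Matrix.convexOn_dotProduct_inv_mulVec {m : Type*} [Fintype m] [DecidableEq m] (f : m → ℝ) :
    ConvexOn ℝ {M : Matrix m m ℝ | M.PosDef} (fun M => f ⬝ᵥ M⁻¹ *ᵥ f) := by
  have hconv : Convex ℝ {M : Matrix m m ℝ | M.PosDef} :=
    convex_iff_forall_pos.2 fun M hM N hN a b ha hb _ => (hM.smul ha).add (hN.smul hb)
  refine ⟨hconv, fun M hM N hN a b ha hb hab => ?_⟩
  have hP : (a • M + b • N).PosDef := hconv hM hN ha hb hab
  obtain ⟨x, hx⟩ : ∃ x, x = (a • M + b • N)⁻¹ *ᵥ f := ⟨_, rfl⟩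
  have hf : (a • M + b • N) *ᵥ x = f := by
    rw [hx, mulVec_mulVec, mul_nonsing_inv _ ((isUnit_iff_isUnit_det _).1 hP.isUnit), one_mulVec]
  have hq : a * (x ⬝ᵥ M *ᵥ x) + b * (x ⬝ᵥ N *ᵥ x) = f ⬝ᵥ x := by
    rw [dotProduct_comm f x, ← hf]
    simp [add_mulVec, smul_mulVec]
  have h₁ := mul_le_mul_of_nonneg_left (PosDef.two_mul_dotProduct_sub_le hM f x) ha
  have h₂ := mul_le_mul_of_nonneg_left (PosDef.two_mul_dotProduct_sub_le hN f x) hb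
  simp only [smul_eq_mul, ← hx]
  linear_combination h₁ + h₂ + hq - 2 * (f ⬝ᵥ x) * hab

lemma G_convex_combination {n p : ℕ} (A : Matrix (Fin n) (Fin n) ℝ)
    (B : Fin p → Matrix (Fin n) (Fin n) ℝ) (σ τ : Fin p → ℝ) {a b : ℝ} (hab : a + b = 1) :
    G A B (a • σ + b • τ) = a • G A B σ + b • G A B τ := by
  have hA : A = a • A + b • A := by rw [← add_smul, hab, one_smul]
  simp only [G, Pi.add_apply, Pi.smul_apply, smul_eq_mul, add_smul, mul_smul,
    Finset.sum_add_distrib, ← Finset.smul_sum, smul_add]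
  nth_rewrite 1 [hA]
  abel

/-- Concavity of the canonical dual function on `S⁺`: the set
`S⁺ = {σ : G(σ) ≻ 0}` is convex, `σ ↦ fᵀ G(σ)⁻¹ f` is convex on `S⁺`, and `Π_d`
is concave on `S⁺`. -/
theorem stmt_17 (n p : ℕ) (hn : 0 < n) (hp : 0 < p)
    (A : Matrix (Fin n) (Fin n) ℝ) (hA : A.IsSymm)
    (B : Fin p → Matrix (Fin n) (Fin n) ℝ) (hB : ∀ i, (B i).IsSymm)
    (K : Matrix (Fin p) (Fin p) ℝ) (hK : K.PosDef)
    (f : Fin n → ℝ) (ℓ : Fin p → ℝ) (c : ℝ) :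
    Convex ℝ {σ : Fin p → ℝ | (G A B σ).PosDef} ∧
      ConvexOn ℝ {σ : Fin p → ℝ | (G A B σ).PosDef}
        (fun σ => f ⬝ᵥ (G A B σ)⁻¹.mulVec f) ∧
      ConcaveOn ℝ {σ : Fin p → ℝ | (G A B σ).PosDef} (Pid A B K f ℓ c) := by
  have hinv := Matrix.convexOn_dotProduct_inv_mulVec f
  have hS : Convex ℝ {σ : Fin p → ℝ | (G A B σ).PosDef} := by
    intro σ hσ τ hτ a b ha hb hab
    simpa only [Set.mem_ofPred_eq, G_convex_combination A B σ τ hab] using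
      hinv.1 hσ hτ ha hb hab
  have hconv : ConvexOn ℝ {σ : Fin p → ℝ | (G A B σ).PosDef}
      (fun σ => f ⬝ᵥ (G A B σ)⁻¹.mulVec f) := by
    refine ⟨hS, fun σ hσ τ hτ a b ha hb hab => ?_⟩
    simpa only [G_convex_combination A B σ τ hab] using hinv.2 hσ hτ ha hb hab
  refine ⟨hS, hconv, hS, fun σ hσ τ hτ a b ha hb hab => ?_⟩
  have h₁ := hconv.2 hσ hτ ha hb hab
  have h₂ := hK.posSemidef.convexOn_dotProduct_mulVec.2 (Set.mem_univ σ) (Set.mem_univ τ) ha hb hab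
  simp only [smul_eq_mul] at h₁ h₂
  simp only [Pid, smul_eq_mul, dotProduct_add, dotProduct_smul]
  linear_combination (1 / 2) * h₁ + (1 / 2) * h₂ - c * hab
end
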